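/- Let L ≥ 3 and let n be sufficiently large with (2L·log n)^{2L} ≤ n^{1/4}. Let G = (V,E) be a simple graph on n vertices in which every two distinct vertices have at least one common neighbor and at most (log n)^2 common neighbors, and in which every vertex has degree at most 2√n · log n. Define x_S = n^{−(st(S)+1)/4} · L^{−|S|} for nonempty S ⊆ V, where st(S) is the minimum Steiner tree size of S in G. Then for every nonempty S ⊆ V with |S| ≤ L/2, the size constraint holds: Σ_{i∈V} x_{S∪{i}} ≤ √n · x_S. -/

import Mathlib

/-- The minimum Steiner tree size of a nonempty set `S` of vertices in `G`:
the least cardinality of a set `T ⊇ S` inducing a connected subgraph of `G`. -/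
noncomputable def steinerSize {n : ℕ} (G : SimpleGraph (Fin n)) (S : Finset (Fin n)) : ℕ :=
  sInf {m : ℕ | ∃ T : Finset (Fin n), S ⊆ T ∧ T.card = m ∧
    (G.induce (T : Set (Fin n))).Connected}

section Joined

variable {V : Type*} (G : SimpleGraph V)

/-- `x` and `y` are joined by a walk of `G` all of whose edges lie inside `A`. -/
def JoinedInside (A : Finset V) (x y : V) : Prop :=
  Relation.ReflTransGen (fun a b => G.Adj a b ∧ a ∈ A ∧ b ∈ A) x y

/-- `R` is a subset of `A` that meets every connected component of `G[A]`. -/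
def IsRepSet (A R : Finset V) : Prop :=
  R ⊆ A ∧ ∀ x ∈ A, ∃ r ∈ R, JoinedInside G A x r

variable {G}

lemma JoinedInside.mono {A B : Finset V} (hAB : A ⊆ B) {x y : V} (h : JoinedInside G A x y) :
    JoinedInside G B x y :=
  Relation.ReflTransGen.mono (fun _ _ hab => ⟨hab.1, hAB hab.2.1, hAB hab.2.2⟩) _ _ h

lemma JoinedInside.symm {A : Finset V} {x y : V} (h : JoinedInside G A x y) : JoinedInside G A y x :=
  Relation.ReflTransGen.mono (fun _ _ hab => ⟨hab.1.symm, hab.2.2, hab.2.1⟩) _ _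
    (Relation.ReflTransGen.swap _ _ h)

lemma joinedInside_of_connected {T : Finset V} (hT : (G.induce (T : Set V)).Connected)
    {x y : V} (hx : x ∈ T) (hy : y ∈ T) : JoinedInside G T x y := by
  have h := hT.preconnected ⟨x, hx⟩ ⟨y, hy⟩
  rw [SimpleGraph.reachable_iff_reflTransGen] at h
  exact Relation.ReflTransGen.lift (p := fun a b => G.Adj a b ∧ a ∈ T ∧ b ∈ T) Subtype.val
    (fun a b hab => ⟨hab, a.2, b.2⟩) _ _ h

lemma connected_of_joinedInside {T : Finset V} {r : V} (hr : r ∈ T)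
    (h : ∀ x ∈ T, JoinedInside G T x r) : (G.induce (T : Set V)).Connected := by
  have key : ∀ x, JoinedInside G T x r → ∀ hx : x ∈ T,
      (G.induce (T : Set V)).Reachable ⟨x, hx⟩ ⟨r, hr⟩ := by
    intro x hxr
    induction hxr using Relation.ReflTransGen.head_induction_on with
    | refl => intro _; exact SimpleGraph.Reachable.refl _
    | head hab _ ih =>
      intro ha
      have hadj : (G.induce (T : Set V)).Adj ⟨_, ha⟩ ⟨_, hab.2.2⟩ := hab.1
      exact hadj.reachable.trans (ih hab.2.2)
  have : Nonempty (T : Set V) := ⟨⟨r, hr⟩⟩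
  refine ⟨fun x y => ?_⟩
  exact (key x (h x x.2) x.2).trans (key y (h y y.2) y.2).symm

lemma isRepSet_singleton {T : Finset V} (hT : (G.induce (T : Set V)).Connected) {t : V}
    (ht : t ∈ T) : IsRepSet G T {t} :=
  ⟨by simpa using ht, fun _ hx => ⟨t, by simp, joinedInside_of_connected hT hx ht⟩⟩

lemma isRepSet_self (A : Finset V) : IsRepSet G A A :=
  ⟨subset_rfl, fun x hx => ⟨x, hx, Relation.ReflTransGen.refl⟩⟩

/-- If every two distinct vertices have a common neighbor, a set represented by `R` becomes
connected after adding at most `|R| - 1` vertices. -/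
lemma IsRepSet.exists_connected [DecidableEq V]
    (hG : ∀ u v : V, u ≠ v → ∃ w, G.Adj u w ∧ G.Adj v w)
    {A R : Finset V} (hA : A.Nonempty) (hR : IsRepSet G A R) :
    ∃ T : Finset V, A ⊆ T ∧ (G.induce (T : Set V)).Connected ∧
      T.card + 1 ≤ A.card + R.card := by
  obtain ⟨a, ha⟩ := hA
  obtain ⟨r₀, hr₀, -⟩ := hR.2 a ha
  have hw : ∀ r : V, ∃ w, r ≠ r₀ → G.Adj r w ∧ G.Adj r₀ w := by
    intro r
    by_cases h : r = r₀
    · exact ⟨r, fun h' => absurd h h'⟩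
    · obtain ⟨w, hw⟩ := hG r r₀ h
      exact ⟨w, fun _ => hw⟩
  choose w hw using hw
  have hsub : A ⊆ A ∪ (R.erase r₀).image w := Finset.subset_union_left
  have hmem : ∀ r ∈ R, r ≠ r₀ → w r ∈ A ∪ (R.erase r₀).image w := fun r hr hne =>
    Finset.mem_union_right _ (Finset.mem_image_of_mem _ (Finset.mem_erase.2 ⟨hne, hr⟩))
  have hr₀T := hsub (hR.1 hr₀)
  have hstep : ∀ r ∈ R, r ≠ r₀ → JoinedInside G (A ∪ (R.erase r₀).image w) (w r) r₀ :=
    fun r hr hne => Relation.ReflTransGen.single ⟨(hw r hne).2.symm, hmem r hr hne, hr₀T⟩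
  refine ⟨A ∪ (R.erase r₀).image w, hsub, connected_of_joinedInside hr₀T ?_, ?_⟩
  · intro x hx
    rcases Finset.mem_union.1 hx with hx | hx
    · obtain ⟨r, hr, hxr⟩ := hR.2 x hx
      by_cases hne : r = r₀
      · exact hne ▸ hxr.mono hsub
      · refine (hxr.mono hsub).trans (Relation.ReflTransGen.head ?_ (hstep r hr hne))
        exact ⟨(hw r hne).1, hsub (hR.1 hr), hmem r hr hne⟩
    · obtain ⟨r, hr, rfl⟩ := Finset.mem_image.1 hx
      exact hstep r (Finset.mem_of_mem_erase hr) (Finset.ne_of_mem_erase hr)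
  · have h1 := Finset.card_union_le A ((R.erase r₀).image w)
    have h2 := Finset.card_image_le (s := R.erase r₀) (f := w)
    have h3 := Finset.card_erase_add_one hr₀
    omega

open Classical in
lemma JoinedInside.restrict {A W : Finset V} {x y : V} (hx : x ∈ A) (h : JoinedInside G (A ∪ W) x y) :
    (y ∈ A ∧ JoinedInside G A x y) ∨
      ∃ p ∈ W.biUnion (fun w => A.filter (G.Adj w)), JoinedInside G A x p := by
  induction h with
  | refl => exact Or.inl ⟨hx, Relation.ReflTransGen.refl⟩
  | @tail b c _ hbc ih =>
    rcases ih with ⟨hb, hj⟩ | h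
    · by_cases hc : c ∈ A
      · exact Or.inl ⟨hc, hj.tail ⟨hbc.1, hb, hc⟩⟩
      · have hcW : c ∈ W := (Finset.mem_union.1 hbc.2.2).resolve_left hc
        exact Or.inr ⟨b, Finset.mem_biUnion.2 ⟨c, hcW, Finset.mem_filter.2 ⟨hb, hbc.1.symm⟩⟩, hj⟩
    · exact Or.inr h

open Classical in
/-- Removing a nonempty set `W` of vertices with at most one neighbor each in the rest `A`
increases the number of connected components by less than `|W|`. -/
lemma IsRepSet.exists_of_union {A W R : Finset V} (hAW : Disjoint A W) (hW : W.Nonempty)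
    (hdeg : ∀ w ∈ W, (A.filter (G.Adj w)).card ≤ 1) (hR : IsRepSet G (A ∪ W) R) :
    ∃ R' : Finset V, IsRepSet G A R' ∧ R'.card + 1 ≤ R.card + W.card := by
  set P := W.biUnion (fun w => A.filter (G.Adj w)) with hP
  have hPA : P ⊆ A := Finset.biUnion_subset.2 fun w _ => Finset.filter_subset _ _
  have hPcard : P.card ≤ W.card := by
    simpa using Finset.card_biUnion_le_card_mul W _ 1 hdeg
  by_cases hRW : R ⊆ A
  · obtain ⟨u, hu⟩ := hW
    obtain ⟨r₀, hr₀, hur⟩ := hR.2 u (Finset.mem_union_right _ hu)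
    obtain ⟨p₀, hp₀, hrp⟩ := (hur.symm.restrict (hRW hr₀)).resolve_left
      (fun h => Finset.disjoint_left.1 hAW h.1 hu)
    refine ⟨R.erase r₀ ∪ P,
      ⟨Finset.union_subset ((Finset.erase_subset _ _).trans hRW) hPA, fun x hx => ?_⟩, ?_⟩
    · obtain ⟨r, hr, hxr⟩ := hR.2 x (Finset.mem_union_left _ hx)
      rcases hxr.restrict hx with ⟨-, hj⟩ | ⟨p, hp, hj⟩
      · by_cases hne : r = r₀
        · subst hne
          exact ⟨p₀, Finset.mem_union_right _ hp₀, hj.trans hrp⟩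
        · exact ⟨r, Finset.mem_union_left _ (Finset.mem_erase.2 ⟨hne, hr⟩), hj⟩
      · exact ⟨p, Finset.mem_union_right _ hp, hj⟩
    · have h1 := Finset.card_union_le (R.erase r₀) P
      have h2 := Finset.card_erase_add_one hr₀
      omega
  · refine ⟨R.filter (· ∈ A) ∪ P,
      ⟨Finset.union_subset (fun x hx => (Finset.mem_filter.1 hx).2) hPA, fun x hx => ?_⟩, ?_⟩
    · obtain ⟨r, hr, hxr⟩ := hR.2 x (Finset.mem_union_left _ hx)
      rcases hxr.restrict hx with ⟨hrA, hj⟩ | ⟨p, hp, hj⟩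
      · exact ⟨r, Finset.mem_union_left _ (Finset.mem_filter.2 ⟨hr, hrA⟩), hj⟩
      · exact ⟨p, Finset.mem_union_right _ hp, hj⟩
    · have h1 := Finset.card_union_le (R.filter (· ∈ A)) P
      have h2 : (R.filter (· ∈ A)).card < R.card :=
        Finset.card_lt_card ((Finset.filter_ssubset).2 (Finset.not_subset.1 hRW))
      omega

lemma exists_adj_of_connected {A T : Finset V} (hT : (G.induce (T : Set V)).Connected)
    (hA : A.Nonempty) (hAT : A ⊂ T) : ∃ a ∈ A, ∃ u ∈ T, u ∉ A ∧ G.Adj a u := by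
  by_contra! hno
  obtain ⟨a, ha⟩ := hA
  obtain ⟨u, hu, huA⟩ := Finset.exists_of_ssubset hAT
  have key : ∀ y, JoinedInside G T a y → y ∈ A := by
    intro y hy
    induction hy with
    | refl => exact ha
    | tail _ hbc ih =>
      by_contra hc
      exact hno _ ih _ hbc.2.2 hc hbc.1
  exact huA (key u (joinedInside_of_connected hT (hAT.1 ha) hu))

end Joined

lemma card_biUnion_le_mul_real {α β : Type*} [DecidableEq β] (F : Finset α) (f : α → Finset β) {c : ℝ}
    (h : ∀ a ∈ F, ((f a).card : ℝ) ≤ c) : ((F.biUnion f).card : ℝ) ≤ F.card * c := by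
  calc ((F.biUnion f).card : ℝ) ≤ ∑ a ∈ F, ((f a).card : ℝ) := by
        exact_mod_cast Finset.card_biUnion_le
    _ ≤ F.card * c := by simpa using Finset.sum_le_sum h

section Growth

open Classical

variable {V : Type*} [Fintype V] (G : SimpleGraph V)

/-- The sets obtained from `A` by adding a vertex with at least two neighbors in `A`. -/
noncomputable def pairExtensions (A : Finset V) : Finset (Finset V) :=
  (A.offDiag.biUnion fun p =>
    Finset.univ.filter fun w => w ∉ A ∧ G.Adj p.1 w ∧ G.Adj p.2 w).image (insert · A)

/-- The sets obtained from `A` by adding a vertex with at least one neighbor in `A`. -/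
noncomputable def edgeExtensions (A : Finset V) : Finset (Finset V) :=
  (A.biUnion fun a => Finset.univ.filter fun w => w ∉ A ∧ G.Adj a w).image (insert · A)

/-- The sets obtained from `S` by `j` pair extensions. -/
noncomputable def pairGrowth (S : Finset V) : ℕ → Finset (Finset V)
  | 0 => {S}
  | j + 1 => (pairGrowth S j).biUnion (pairExtensions G)

/-- The sets obtained from `S` by `j` extensions, all pair extensions except at most one
edge extension. -/
noncomputable def edgeGrowth (S : Finset V) : ℕ → Finset (Finset V)
  | 0 => {S}
  | j + 1 => (edgeGrowth S j).biUnion (pairExtensions G) ∪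
      (pairGrowth G S j).biUnion (edgeExtensions G)

variable {G}

lemma insert_mem_pairExtensions {A : Finset V} {w : V} (hw : w ∉ A)
    (h : 1 < (A.filter (G.Adj w)).card) : insert w A ∈ pairExtensions G A := by
  obtain ⟨a, ha, b, hb, hab⟩ := Finset.one_lt_card.1 h
  rw [Finset.mem_filter] at ha hb
  refine Finset.mem_image_of_mem _ (Finset.mem_biUnion.2 ⟨(a, b), ?_, ?_⟩)
  · exact Finset.mem_offDiag.2 ⟨ha.1, hb.1, hab⟩
  · simpa using ⟨hw, ha.2.symm, hb.2.symm⟩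

lemma insert_mem_edgeExtensions {A : Finset V} {a w : V} (ha : a ∈ A) (hw : w ∉ A)
    (h : G.Adj a w) : insert w A ∈ edgeExtensions G A :=
  Finset.mem_image_of_mem _ (Finset.mem_biUnion.2 ⟨a, ha, by simpa using ⟨hw, h⟩⟩)

lemma card_of_mem_pairExtensions {A B : Finset V} (hB : B ∈ pairExtensions G A) :
    B.card = A.card + 1 := by
  obtain ⟨w, hw, rfl⟩ := Finset.mem_image.1 hB
  simp only [Finset.mem_biUnion, Finset.mem_filter] at hw
  obtain ⟨_, _, _, hw, _⟩ := hw
  exact Finset.card_insert_of_notMem hw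

lemma card_of_mem_edgeExtensions {A B : Finset V} (hB : B ∈ edgeExtensions G A) :
    B.card = A.card + 1 := by
  obtain ⟨w, hw, rfl⟩ := Finset.mem_image.1 hB
  simp only [Finset.mem_biUnion, Finset.mem_filter] at hw
  obtain ⟨_, _, _, hw, _⟩ := hw
  exact Finset.card_insert_of_notMem hw

lemma card_of_mem_pairGrowth {S : Finset V} {j : ℕ} {A : Finset V}
    (hA : A ∈ pairGrowth G S j) : A.card = S.card + j := by
  induction j generalizing A with
  | zero => simp_all [pairGrowth]
  | succ j ih =>
    obtain ⟨B, hB, hAB⟩ := Finset.mem_biUnion.1 hA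
    rw [card_of_mem_pairExtensions hAB, ih hB, add_assoc]

lemma card_of_mem_edgeGrowth {S : Finset V} {j : ℕ} {A : Finset V}
    (hA : A ∈ edgeGrowth G S j) : A.card = S.card + j := by
  induction j generalizing A with
  | zero => simp_all [edgeGrowth]
  | succ j ih =>
    rcases Finset.mem_union.1 hA with hA | hA <;> obtain ⟨B, hB, hAB⟩ := Finset.mem_biUnion.1 hA
    · rw [card_of_mem_pairExtensions hAB, ih hB, add_assoc]
    · rw [card_of_mem_edgeExtensions hAB, card_of_mem_pairGrowth hB, add_assoc]

lemma pairGrowth_subset_edgeGrowth (S : Finset V) (j : ℕ) :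
    pairGrowth G S j ⊆ edgeGrowth G S j := by
  induction j with
  | zero => exact subset_rfl
  | succ j ih =>
    exact (Finset.biUnion_subset_biUnion_of_subset_left _ ih).trans Finset.subset_union_left

/-- In a family of sets closed under pair extensions, every member inside `T` can be enlarged to
a member `A` inside `T` such that each vertex of `T` outside `A` has at most one neighbor
in `A`. -/
lemma exists_closed_of_extensions {F : ℕ → Finset (Finset V)}
    (hF : ∀ j, ∀ A ∈ F j, ∀ B ∈ pairExtensions G A, B ∈ F (j + 1))
    {T A₀ : Finset V} {j₀ : ℕ} (hA₀ : A₀ ∈ F j₀) (hT : A₀ ⊆ T) :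
    ∃ j, ∃ A ∈ F j, A₀ ⊆ A ∧ A ⊆ T ∧
      ∀ w ∈ T, w ∉ A → (A.filter (G.Adj w)).card ≤ 1 := by
  obtain ⟨A, hA, hmax⟩ := Finset.exists_max_image
    (T.powerset.filter fun A => A₀ ⊆ A ∧ ∃ j, A ∈ F j) Finset.card
    ⟨A₀, by simpa using ⟨hT, j₀, hA₀⟩⟩
  simp only [Finset.mem_filter, Finset.mem_powerset] at hA hmax
  obtain ⟨hAT, hA₀A, j, hj⟩ := hA
  refine ⟨j, A, hj, hA₀A, hAT, fun w hwT hwA => ?_⟩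
  by_contra! hlt
  have := hmax (insert w A) ⟨Finset.insert_subset hwT hAT,
    hA₀A.trans (Finset.subset_insert _ _), j + 1,
    hF j A hj _ (insert_mem_pairExtensions hwA hlt)⟩
  rw [Finset.card_insert_of_notMem hwA] at this
  omega

/-- A minimum connected set containing `S` arises from `S` by pair extensions. -/
lemma mem_pairGrowth_of_minimal {S T : Finset V} {s : ℕ} (hS : S.Nonempty) (hST : S ⊆ T)
    (hT : (G.induce (T : Set V)).Connected)
    (hmin : ∀ A R : Finset V, S ⊆ A → IsRepSet G A R → s + 1 ≤ A.card + R.card)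
    (hcard : T.card = s) : T ∈ pairGrowth G S (s - S.card) := by
  obtain ⟨j, A, hA, hSA, hAT, hcl⟩ := exists_closed_of_extensions (F := pairGrowth G S)
    (fun j A hA B hB => Finset.mem_biUnion.2 ⟨A, hA, hB⟩) (j₀ := 0) (by simp [pairGrowth]) hST
  by_cases hEq : A = T
  · subst hEq
    have := card_of_mem_pairGrowth hA
    rwa [← hcard, this, Nat.add_sub_cancel_left]
  exfalso
  have hne : (T \ A).Nonempty := Finset.sdiff_nonempty.2 fun h => hEq (hAT.antisymm h)
  obtain ⟨t, ht⟩ := hS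
  have hrep := isRepSet_singleton hT (hST ht)
  rw [← Finset.union_sdiff_of_subset hAT] at hrep
  obtain ⟨R, hR, hRc⟩ := hrep.exists_of_union Finset.disjoint_sdiff hne
    (fun w hw => hcl w (Finset.mem_sdiff.1 hw).1 (Finset.mem_sdiff.1 hw).2)
  have h1 := hmin A R hSA hR
  have h2 := Finset.card_sdiff_add_card_eq_card hAT
  simp only [Finset.card_singleton] at hRc
  omega

/-- A connected set containing `S` with one vertex more than the minimum arises from `S` by pair
extensions and at most one edge extension. -/
lemma mem_edgeGrowth_of_almost_minimal {S T : Finset V} {s : ℕ} (hS : S.Nonempty) (hST : S ⊆ T)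
    (hT : (G.induce (T : Set V)).Connected)
    (hmin : ∀ A R : Finset V, S ⊆ A → IsRepSet G A R → s + 1 ≤ A.card + R.card)
    (hcard : T.card = s + 1) : T ∈ edgeGrowth G S (s + 1 - S.card) := by
  obtain ⟨j, A, hA, hSA, hAT, hcl⟩ := exists_closed_of_extensions (F := pairGrowth G S)
    (fun j A hA B hB => Finset.mem_biUnion.2 ⟨A, hA, hB⟩) (j₀ := 0) (by simp [pairGrowth]) hST
  have hfin : ∀ k, T ∈ edgeGrowth G S k → T ∈ edgeGrowth G S (s + 1 - S.card) := by
    intro k hk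
    have := card_of_mem_edgeGrowth hk
    rwa [← hcard, this, Nat.add_sub_cancel_left]
  by_cases hEq : A = T
  · subst hEq
    exact hfin j (pairGrowth_subset_edgeGrowth S j hA)
  obtain ⟨a, ha, u, huT, huA, hau⟩ :=
    exists_adj_of_connected hT (hS.mono hSA) (hAT.ssubset_of_ne hEq)
  obtain ⟨k, B, hB, hAB, hBT, hclB⟩ := exists_closed_of_extensions (F := edgeGrowth G S)
    (fun j A hA B hB => Finset.mem_union_left _ (Finset.mem_biUnion.2 ⟨A, hA, hB⟩))
    (j₀ := j + 1) (Finset.mem_union_right _ (Finset.mem_biUnion.2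
      ⟨A, hA, insert_mem_edgeExtensions ha huA hau⟩)) (Finset.insert_subset huT hAT)
  by_cases hBEq : B = T
  · subst hBEq
    exact hfin k hB
  exfalso
  have huB : u ∈ B := hAB (Finset.mem_insert_self _ _)
  have hAB' : A ⊆ B := (Finset.subset_insert _ _).trans hAB
  have hne : (T \ B).Nonempty := Finset.sdiff_nonempty.2 fun h => hBEq (hBT.antisymm h)
  obtain ⟨t, ht⟩ := hS
  have hrep := isRepSet_singleton hT (hST ht)
  rw [← Finset.union_sdiff_of_subset hBT] at hrep
  obtain ⟨R, hR, hRc⟩ := hrep.exists_of_union Finset.disjoint_sdiff hne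
    (fun w hw => hclB w (Finset.mem_sdiff.1 hw).1 (Finset.mem_sdiff.1 hw).2)
  rw [← Finset.union_sdiff_of_subset hAB'] at hR
  obtain ⟨R', hR', hRc'⟩ := hR.exists_of_union Finset.disjoint_sdiff
    ⟨u, Finset.mem_sdiff.2 ⟨huB, huA⟩⟩
    (fun w hw => hcl w (hBT (Finset.mem_sdiff.1 hw).1) (Finset.mem_sdiff.1 hw).2)
  have h1 := hmin A R' hSA hR'
  have h2 := Finset.card_sdiff_add_card_eq_card hBT
  have h3 := Finset.card_sdiff_add_card_eq_card hAB'
  simp only [Finset.card_singleton] at hRc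
  omega

lemma card_pairExtensions_le {A : Finset V} {L : ℕ} {c : ℝ} (hA : A.card ≤ L) (hc : 0 ≤ c)
    (hG : ∀ u v : V, u ≠ v → ((Finset.univ.filter fun w => G.Adj u w ∧ G.Adj v w).card : ℝ) ≤ c) :
    ((pairExtensions G A).card : ℝ) ≤ L ^ 2 * c := by
  have h1 : ((pairExtensions G A).card : ℝ) ≤ A.offDiag.card * c := by
    refine le_trans (Nat.cast_le.2 Finset.card_image_le) (card_biUnion_le_mul_real _ _ ?_)
    intro p hp
    refine le_trans (Nat.cast_le.2 (Finset.card_le_card ?_))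
      (hG p.1 p.2 (Finset.mem_offDiag.1 hp).2.2)
    exact Finset.monotone_filter_right _ fun w _ hw => hw.2
  refine h1.trans (mul_le_mul_of_nonneg_right ?_ hc)
  have h2 : A.offDiag.card ≤ L ^ 2 := by
    rw [Finset.offDiag_card, sq]
    exact (Nat.sub_le _ _).trans (Nat.mul_le_mul hA hA)
  exact_mod_cast h2

lemma card_edgeExtensions_le {A : Finset V} {L : ℕ} {D : ℝ} (hA : A.card ≤ L) (hD : 0 ≤ D)
    (hG : ∀ v : V, ((Finset.univ.filter fun w => G.Adj v w).card : ℝ) ≤ D) :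
    ((edgeExtensions G A).card : ℝ) ≤ L * D := by
  have h1 : ((edgeExtensions G A).card : ℝ) ≤ A.card * D := by
    refine le_trans (Nat.cast_le.2 Finset.card_image_le) (card_biUnion_le_mul_real _ _ ?_)
    intro a _
    refine le_trans (Nat.cast_le.2 (Finset.card_le_card ?_)) (hG a)
    exact Finset.monotone_filter_right _ fun w _ hw => hw.2
  exact h1.trans (mul_le_mul_of_nonneg_right (Nat.cast_le.2 hA) hD)

lemma card_pairGrowth_le {S : Finset V} {L : ℕ} {K : ℝ} (hK : 0 ≤ K)
    (hpair : ∀ A : Finset V, A.card ≤ L → ((pairExtensions G A).card : ℝ) ≤ K) {j : ℕ}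
    (hj : S.card + j ≤ L) : ((pairGrowth G S j).card : ℝ) ≤ K ^ j := by
  induction j with
  | zero => simp [pairGrowth]
  | succ j ih =>
    refine (card_biUnion_le_mul_real _ _ (c := K) fun A hA => hpair A ?_).trans ?_
    · rw [card_of_mem_pairGrowth hA]; omega
    · rw [pow_succ]
      exact mul_le_mul_of_nonneg_right (ih (by omega)) hK

lemma card_edgeGrowth_le {S : Finset V} {L : ℕ} {K D : ℝ} (hK : 1 ≤ K) (hD : 0 ≤ D)
    (hpair : ∀ A : Finset V, A.card ≤ L → ((pairExtensions G A).card : ℝ) ≤ K)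
    (hedge : ∀ A : Finset V, A.card ≤ L → ((edgeExtensions G A).card : ℝ) ≤ D) {j : ℕ}
    (hj : S.card + j ≤ L) : ((edgeGrowth G S j).card : ℝ) ≤ (1 + j * D) * K ^ j := by
  have hK0 : 0 ≤ K := zero_le_one.trans hK
  induction j with
  | zero => simp [edgeGrowth]
  | succ j ih =>
    have h1 : (((edgeGrowth G S j).biUnion (pairExtensions G)).card : ℝ)
        ≤ (1 + j * D) * K ^ j * K := by
      refine (card_biUnion_le_mul_real _ _ (c := K) fun A hA => hpair A ?_).trans
        (mul_le_mul_of_nonneg_right (ih (by omega)) hK0)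
      rw [card_of_mem_edgeGrowth hA]; omega
    have h2 : (((pairGrowth G S j).biUnion (edgeExtensions G)).card : ℝ) ≤ K ^ j * D := by
      refine (card_biUnion_le_mul_real _ _ (c := D) fun A hA => hedge A ?_).trans
        (mul_le_mul_of_nonneg_right (card_pairGrowth_le hK0 hpair (by omega)) hD)
      rw [card_of_mem_pairGrowth hA]; omega
    have h3 : ((edgeGrowth G S (j + 1)).card : ℝ) ≤ (1 + j * D) * K ^ j * K + K ^ j * D :=
      le_trans (by exact_mod_cast Finset.card_union_le _ _) (add_le_add h1 h2)
    have h4 : K ^ j * D ≤ K ^ (j + 1) * D :=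
      mul_le_mul_of_nonneg_right (pow_le_pow_right₀ hK (Nat.le_succ j)) hD
    push_cast
    rw [pow_succ] at h4 ⊢
    linarith

end Growth

section Steiner

variable {n : ℕ} {G : SimpleGraph (Fin n)}

lemma steinerSize_le {S T : Finset (Fin n)} (hST : S ⊆ T)
    (hT : (G.induce (T : Set (Fin n))).Connected) : steinerSize G S ≤ T.card :=
  Nat.sInf_le ⟨T, hST, rfl, hT⟩

lemma IsRepSet.steinerSize_add_one_le
    (hG : ∀ u v : Fin n, u ≠ v → ∃ w, G.Adj u w ∧ G.Adj v w)
    {S A R : Finset (Fin n)} (hS : S.Nonempty) (hSA : S ⊆ A)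
    (hR : IsRepSet G A R) : steinerSize G S + 1 ≤ A.card + R.card := by
  obtain ⟨T, hAT, hT, hc⟩ := hR.exists_connected hG (hS.mono hSA)
  exact (Nat.add_le_add_right (steinerSize_le (hSA.trans hAT) hT) 1).trans hc

lemma exists_card_eq_steinerSize (hG : ∀ u v : Fin n, u ≠ v → ∃ w, G.Adj u w ∧ G.Adj v w)
    {S : Finset (Fin n)} (hS : S.Nonempty) :
    ∃ T : Finset (Fin n), S ⊆ T ∧ T.card = steinerSize G S ∧
      (G.induce (T : Set (Fin n))).Connected := by
  obtain ⟨T, hST, hT, -⟩ := (isRepSet_self (G := G) S).exists_connected hG hS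
  exact Nat.sInf_mem (s := {m : ℕ | ∃ T : Finset (Fin n), S ⊆ T ∧ T.card = m ∧
    (G.induce (T : Set (Fin n))).Connected}) ⟨_, T, hST, rfl, hT⟩

lemma steinerSize_le_insert (hG : ∀ u v : Fin n, u ≠ v → ∃ w, G.Adj u w ∧ G.Adj v w)
    {S : Finset (Fin n)} (i : Fin n) :
    steinerSize G S ≤ steinerSize G (insert i S) := by
  obtain ⟨T, hST, hc, hT⟩ := exists_card_eq_steinerSize hG (Finset.insert_nonempty i S)
  exact hc ▸ steinerSize_le ((Finset.subset_insert _ _).trans hST) hT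

/-- The number of vertices that do not increase the minimum Steiner tree size. -/
lemma card_steinerSize_insert_eq_le
    (hG : ∀ u v : Fin n, u ≠ v → ∃ w, G.Adj u w ∧ G.Adj v w)
    {S : Finset (Fin n)} (hS : S.Nonempty) {L : ℕ} {K : ℝ}
    (hL : 2 * S.card ≤ L) (hK : 1 ≤ K)
    (hpair : ∀ A : Finset (Fin n), A.card ≤ L → ((pairExtensions G A).card : ℝ) ≤ K) :
    ((Finset.univ.filter fun i => steinerSize G (insert i S) = steinerSize G S).card : ℝ)
      ≤ K ^ S.card * L := by
  have hs := (isRepSet_self (G := G) S).steinerSize_add_one_le hG hS subset_rfl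
  obtain ⟨T₀, hT₀, hc₀, -⟩ := exists_card_eq_steinerSize hG hS
  have hs' := Finset.card_le_card hT₀
  have hsub : (Finset.univ.filter fun i => steinerSize G (insert i S) = steinerSize G S) ⊆
      (pairGrowth G S (steinerSize G S - S.card)).biUnion id := by
    intro i hi
    obtain ⟨T, hST, hc, hT⟩ := exists_card_eq_steinerSize hG (Finset.insert_nonempty i S)
    refine Finset.mem_biUnion.2 ⟨T, ?_, hST (Finset.mem_insert_self _ _)⟩
    exact mem_pairGrowth_of_minimal hS ((Finset.subset_insert _ _).trans hST) hT
      (fun A R hSA hR => hR.steinerSize_add_one_le hG hS hSA)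
      (hc.trans (Finset.mem_filter.1 hi).2)
  refine (Nat.cast_le.2 (Finset.card_le_card hsub)).trans
    ((card_biUnion_le_mul_real _ _ (c := L) fun T hT => ?_).trans
      (mul_le_mul_of_nonneg_right ((card_pairGrowth_le (zero_le_one.trans hK) hpair ?_).trans
        (pow_le_pow_right₀ hK ?_)) (Nat.cast_nonneg _)))
  · have := card_of_mem_pairGrowth hT
    exact Nat.cast_le.2 (by simp only [id]; omega)
  · omega
  · omega

/-- The number of vertices that increase the minimum Steiner tree size by one. -/
lemma card_steinerSize_insert_eq_add_one_le
    (hG : ∀ u v : Fin n, u ≠ v → ∃ w, G.Adj u w ∧ G.Adj v w)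
    {S : Finset (Fin n)} (hS : S.Nonempty) {L : ℕ} {K D : ℝ} (hL : 2 * S.card ≤ L) (hK : 1 ≤ K) (hD : 0 ≤ D)
    (hpair : ∀ A : Finset (Fin n), A.card ≤ L → ((pairExtensions G A).card : ℝ) ≤ K)
    (hedge : ∀ A : Finset (Fin n), A.card ≤ L → ((edgeExtensions G A).card : ℝ) ≤ D) :
    ((Finset.univ.filter fun i => steinerSize G (insert i S) = steinerSize G S + 1).card : ℝ)
      ≤ (1 + S.card * D) * K ^ S.card * L := by
  have hs := (isRepSet_self (G := G) S).steinerSize_add_one_le hG hS subset_rfl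
  obtain ⟨T₀, hT₀, hc₀, -⟩ := exists_card_eq_steinerSize hG hS
  have hs' := Finset.card_le_card hT₀
  have hsub : (Finset.univ.filter fun i => steinerSize G (insert i S) = steinerSize G S + 1) ⊆
      (edgeGrowth G S (steinerSize G S + 1 - S.card)).biUnion id := by
    intro i hi
    obtain ⟨T, hST, hc, hT⟩ := exists_card_eq_steinerSize hG (Finset.insert_nonempty i S)
    refine Finset.mem_biUnion.2 ⟨T, ?_, hST (Finset.mem_insert_self _ _)⟩
    exact mem_edgeGrowth_of_almost_minimal hS ((Finset.subset_insert _ _).trans hST) hT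
      (fun A R hSA hR => hR.steinerSize_add_one_le hG hS hSA)
      (hc.trans (Finset.mem_filter.1 hi).2)
  refine (Nat.cast_le.2 (Finset.card_le_card hsub)).trans
    ((card_biUnion_le_mul_real _ _ (c := L) fun T hT => ?_).trans
      (mul_le_mul_of_nonneg_right ((card_edgeGrowth_le hK hD hpair hedge ?_).trans ?_)
        (Nat.cast_nonneg _)))
  · have := card_of_mem_edgeGrowth hT
    exact Nat.cast_le.2 (by simp only [id]; omega)
  · omega
  · have hle : steinerSize G S + 1 - S.card ≤ S.card := by omega
    have hle' : ((steinerSize G S + 1 - S.card : ℕ) : ℝ) ≤ S.card := Nat.cast_le.2 hle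
    gcongr

end Steiner

/-- The numerical form of the size constraint, with `q = n ^ (1 / 4)`, `a = |S|`, and `N₀`, `N₁`
the numbers of vertices increasing the minimum Steiner tree size by `0` and `1`. -/
lemma size_constraint_numeric {L a : ℕ} {q ℓ N₀ N₁ : ℝ} (hL : 3 ≤ L) (ha : 2 * a ≤ L)
    (hq : 1 ≤ q) (hℓ : 1 ≤ ℓ) (h : (2 * L * ℓ) ^ (2 * L) ≤ q)
    (h₀ : N₀ ≤ (L ^ 2 * ℓ ^ 2) ^ a * L)
    (h₁ : N₁ ≤ (1 + a * (L * (2 * q ^ 2 * ℓ))) * (L ^ 2 * ℓ ^ 2) ^ a * L) :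
    a + (N₀ + N₁ / q + q ^ 2) / L ≤ q ^ 2 := by
  have hL' : (3 : ℝ) ≤ L := by exact_mod_cast hL
  have ha' : (a : ℝ) * 2 ≤ L := by exact_mod_cast (by omega : a * 2 ≤ L)
  have ha0 : (0 : ℝ) ≤ a := Nat.cast_nonneg a
  have hLy : (L : ℝ) ≤ L * ℓ := le_mul_of_one_le_right (by positivity) hℓ
  set y : ℝ := L * ℓ with hy
  have hy1 : 1 ≤ y := by linarith
  have hq0 : 0 < q := by linarith
  have hpow : y ^ (2 * L) * 64 ≤ q := by
    have h2 : (64 : ℝ) ≤ 2 ^ (2 * L) := by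
      calc (64 : ℝ) = 2 ^ 6 := by norm_num
        _ ≤ 2 ^ (2 * L) := pow_le_pow_right₀ (by norm_num) (by omega)
    calc y ^ (2 * L) * 64 ≤ y ^ (2 * L) * 2 ^ (2 * L) := by gcongr
      _ = (2 * L * ℓ) ^ (2 * L) := by rw [← mul_pow, hy]; ring
      _ ≤ q := h
  have hyL : ∀ k ≤ 2 * L, y ^ k * 64 ≤ q := fun k hk =>
    (mul_le_mul_of_nonneg_right (pow_le_pow_right₀ hy1 hk) (by norm_num)).trans hpow
  have hK : ((L : ℝ) ^ 2 * ℓ ^ 2) ^ a ≤ y ^ L := by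
    rw [← mul_pow, ← hy, ← pow_mul]
    exact pow_le_pow_right₀ hy1 ha
  have hN₀ : N₀ * 64 ≤ q := by
    calc N₀ * 64 ≤ y ^ L * y * 64 := by
          gcongr
          exact h₀.trans (by gcongr)
      _ = y ^ (L + 1) * 64 := by ring
      _ ≤ q := hyL _ (by omega)
  have hN₁ : N₁ * 64 ≤ 2 * q ^ 3 := by
    have hfac : 1 + a * (L * (2 * q ^ 2 * ℓ)) ≤ 2 * y ^ 2 * q ^ 2 := by
      have e1 : (a : ℝ) * (L * (2 * q ^ 2 * ℓ)) = (a * 2) * (y * q ^ 2) := by rw [hy]; ring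
      have e2 : (a * 2 : ℝ) * (y * q ^ 2) ≤ y * (y * q ^ 2) := by
        gcongr
        exact ha'.trans hLy
      have e3 : 1 ≤ y ^ 2 * q ^ 2 := one_le_mul_of_one_le_of_one_le
        (one_le_pow₀ hy1) (one_le_pow₀ hq)
      rw [e1]
      linarith
    calc N₁ * 64 ≤ 2 * y ^ 2 * q ^ 2 * y ^ L * y * 64 := by
          gcongr
          exact h₁.trans (by gcongr)
      _ = 2 * q ^ 2 * (y ^ (L + 3) * 64) := by ring
      _ ≤ 2 * q ^ 2 * q := by
          gcongr
          exact hyL _ (by omega)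
      _ = 2 * q ^ 3 := by ring
  have hqq : q ≤ q ^ 2 := by nlinarith
  have haq : (a : ℝ) * 64 ≤ q ^ 2 := by
    have := hyL 1 (by omega)
    rw [pow_one] at this
    linarith
  have hN₁q : N₁ / q * 64 ≤ 2 * q ^ 2 := by
    rw [div_mul_eq_mul_div, div_le_iff₀ hq0]
    linarith
  have hdiv : (N₀ + N₁ / q + q ^ 2) / L ≤ q ^ 2 / 2 := by
    rw [div_le_iff₀ (by linarith)]
    nlinarith [sq_nonneg q]
  linarith

/-- For sufficiently large `n` and `L ≥ 3` with
`(2L log n)^{2L} ≤ n^{1/4}`, in any graph `G` on `n` vertices where every two distinct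
vertices have between `1` and `(log n)²` common neighbors and every vertex has degree at
most `2√n log n`, the solution `x S = n^{-(st(S)+1)/4} L^{-|S|}` satisfies the size
constraint `∑_{i ∈ V} x (S ∪ {i}) ≤ √n · x S` for every nonempty `S` with `|S| ≤ L/2`. -/
theorem size_constraint : ∃ n₀ : ℕ, ∀ n : ℕ, n₀ ≤ n → ∀ L : ℕ, 3 ≤ L →
    ((2 * L : ℝ) * Real.log n) ^ (2 * L) ≤ (n : ℝ) ^ ((1 : ℝ) / 4) →
    ∀ G : SimpleGraph (Fin n),
    (∀ u v : Fin n, u ≠ v →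
      1 ≤ Set.ncard {w : Fin n | G.Adj u w ∧ G.Adj v w} ∧
      (Set.ncard {w : Fin n | G.Adj u w ∧ G.Adj v w} : ℝ) ≤ (Real.log n) ^ 2) →
    (∀ v : Fin n,
      (Set.ncard {u : Fin n | G.Adj v u} : ℝ) ≤ 2 * Real.sqrt n * Real.log n) →
    ∀ x : Finset (Fin n) → ℝ,
    (∀ S : Finset (Fin n), S.Nonempty →
      x S = (n : ℝ) ^ (-(((steinerSize G S : ℝ) + 1) / 4)) * (L : ℝ) ^ (-(S.card : ℝ))) →
    ∀ S : Finset (Fin n), S.Nonempty → (S.card : ℝ) ≤ (L : ℝ) / 2 →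
    ∑ i : Fin n, x (insert i S) ≤ Real.sqrt n * x S := by
  classical
  refine ⟨3, fun n hn L hL hnL G hcn hdeg x hx S hS hSL => ?_⟩
  have hn' : (3 : ℝ) ≤ n := by exact_mod_cast hn
  have hn0 : (0 : ℝ) ≤ n := by linarith
  have hlog : 1 ≤ Real.log n := by
    rw [Real.le_log_iff_exp_le (by linarith)]
    linarith [Real.exp_one_lt_d9]
  have hLpos : (0 : ℝ) < L := by exact_mod_cast (by omega : 0 < L)
  have hSL' : 2 * S.card ≤ L := by
    have : (S.card : ℝ) * 2 ≤ L := by linarith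
    have : S.card * 2 ≤ L := by exact_mod_cast this
    omega
  set q : ℝ := (n : ℝ) ^ ((1 : ℝ) / 4) with hq
  have hq1 : 1 ≤ q := Real.one_le_rpow (by linarith) (by norm_num)
  have hq0 : 0 < q := by linarith
  have hq4 : q ^ 4 = n := by
    rw [hq, ← Real.rpow_natCast, ← Real.rpow_mul hn0]
    norm_num
  have hsqrt : Real.sqrt n = q ^ 2 := by
    rw [← hq4, show q ^ 4 = (q ^ 2) ^ 2 by ring, Real.sqrt_sq (by positivity)]
  have hxq : ∀ A : Finset (Fin n), A.Nonempty →
      x A = (q ^ (steinerSize G A + 1))⁻¹ * ((L : ℝ) ^ A.card)⁻¹ := by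
    intro A hA
    rw [hx A hA, Real.rpow_neg hn0, Real.rpow_neg hLpos.le, Real.rpow_natCast,
      ← Real.rpow_natCast q, hq, ← Real.rpow_mul hn0]
    congr 3
    push_cast
    ring
  have hcommon : ∀ u v : Fin n, u ≠ v → ∃ w, G.Adj u w ∧ G.Adj v w := by
    intro u v huv
    exact Set.nonempty_of_ncard_ne_zero (Nat.one_le_iff_ne_zero.1 (hcn u v huv).1)
  have hpair : ∀ A : Finset (Fin n), A.card ≤ L →
      ((pairExtensions G A).card : ℝ) ≤ L ^ 2 * Real.log n ^ 2 := by
    refine fun A hA => card_pairExtensions_le hA (by positivity) fun u v huv => ?_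
    rw [← Set.ncard_coe_finset]
    simpa using (hcn u v huv).2
  have hedge : ∀ A : Finset (Fin n), A.card ≤ L →
      ((edgeExtensions G A).card : ℝ) ≤ L * (2 * q ^ 2 * Real.log n) := by
    refine fun A hA => card_edgeExtensions_le hA (by positivity) fun v => ?_
    rw [← Set.ncard_coe_finset, ← hsqrt]
    simpa using hdeg v
  have hK : (1 : ℝ) ≤ L ^ 2 * Real.log n ^ 2 := one_le_mul_of_one_le_of_one_le
    (one_le_pow₀ (by exact_mod_cast (by omega : 1 ≤ L))) (one_le_pow₀ hlog)
  have h₀ := card_steinerSize_insert_eq_le hcommon hS hSL' hK hpair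
  have h₁ := card_steinerSize_insert_eq_add_one_le hcommon hS hSL' hK (by positivity) hpair hedge
  have hnum := size_constraint_numeric hL hSL' hq1 hlog hnL h₀ h₁
  have hxS : 0 < x S := by
    rw [hxq S hS]
    positivity
  set s := steinerSize G S with hs
  have hterm : ∀ i : Fin n, x (insert i S) ≤ ((if i ∈ S then 1 else 0) +
      ((if steinerSize G (insert i S) = s then 1 else 0) +
        (if steinerSize G (insert i S) = s + 1 then 1 else 0) / q + 1 / q ^ 2) / L) * x S := by
    intro i
    by_cases hi : i ∈ S
    · rw [Finset.insert_eq_of_mem hi]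
      refine le_mul_of_one_le_left hxS.le ?_
      rw [if_pos hi]
      exact le_add_of_nonneg_right (by positivity)
    · have hfac : ∀ k : ℕ, s + k ≤ steinerSize G (insert i S) →
          x (insert i S) ≤ (1 / q ^ k / L) * x S := by
        intro k hk
        have hle : q ^ (s + k + 1) ≤ q ^ (steinerSize G (insert i S) + 1) :=
          pow_le_pow_right₀ hq1 (by omega)
        rw [hxq _ (Finset.insert_nonempty i S), hxq S hS, Finset.card_insert_of_notMem hi]
        calc _ ≤ (q ^ (s + k + 1))⁻¹ * ((L : ℝ) ^ (S.card + 1))⁻¹ := by gcongr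
          _ = _ := by rw [← hs]; field_simp; ring
      have hmono : s ≤ steinerSize G (insert i S) := steinerSize_le_insert hcommon i
      rw [if_neg hi, zero_add]
      rcases Nat.lt_or_ge (steinerSize G (insert i S)) (s + 2) with hlt | hge
      · rcases Nat.eq_or_lt_of_le hmono with heq | hgt
        · refine (hfac 0 hmono).trans ?_
          rw [if_pos heq.symm, pow_zero, div_one]
          gcongr
          rw [add_assoc]
          exact le_add_of_nonneg_right (by positivity)
        · refine (hfac 1 hgt).trans ?_
          rw [if_pos (show steinerSize G (insert i S) = s + 1 by omega), pow_one]
          gcongr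
          rw [add_right_comm]
          exact le_add_of_nonneg_left (by positivity)
      · refine (hfac 2 hge).trans ?_
        gcongr
        exact le_add_of_nonneg_left (by positivity)
  calc ∑ i : Fin n, x (insert i S) ≤ ∑ i : Fin n, _ := Finset.sum_le_sum fun i _ => hterm i
    _ = (S.card + (((Finset.univ.filter fun i => steinerSize G (insert i S) = s).card : ℝ) +
        ((Finset.univ.filter fun i => steinerSize G (insert i S) = s + 1).card : ℝ) / q +
          q ^ 2) / L) * x S := by
      rw [← Finset.sum_mul, Finset.sum_add_distrib, ← Finset.sum_div, Finset.sum_add_distrib,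
        Finset.sum_add_distrib, ← Finset.sum_div]
      have hlast : ∑ _i : Fin n, 1 / q ^ 2 = q ^ 2 := by
        rw [Finset.sum_const, Finset.card_univ, Fintype.card_fin, nsmul_eq_mul, ← hq4]
        field_simp
      rw [hlast]
      simp
    _ ≤ q ^ 2 * x S := mul_le_mul_of_nonneg_right hnum hxS.le
    _ = Real.sqrt n * x S := by rw [hsqrt]
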